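/- arXiv:1801.03931 — 3 statements merged into one kernel-verified Lean document; each statement's English description precedes it below -/
import Mathlib

section
/- Let d ≥ 1, n = d+1, and fix nonnegative integers ℓ₁, ℓ₂ with ℓ := ℓ₁+ℓ₂ < d. For any symmetrical code that satisfies node regeneration, message recovery (for parameter ℓ), and repair secrecy (for parameters ℓ₁, ℓ₂), and for any real β with H(S_{i→j}) ≤ β for all i ≠ j in [1:n], one has β ≥ Σ_{j=ℓ+1}^{d} T_{d,j,ℓ}^{−1} B_j. (Unnormalized form of outer bound (9) of Theorem 1.) -/
open scoped BigOperators Classical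

namespace MDCSR

noncomputable section

/-- `X` is a deterministic function of `Y`. -/
def IsFuncOf {Ω α β : Type*} (X : Ω → α) (Y : Ω → β) : Prop :=
  ∃ f : β → α, ∀ ω, X ω = f (Y ω)

variable {Ω V : Type} [Fintype Ω]

/-- Probability of the event `X = x` under the probability mass function `p`. -/
def pm (p : Ω → ℝ) {α : Type*} (X : Ω → α) (x : α) : ℝ :=
  ∑ ω ∈ Finset.univ.filter (fun ω' => X ω' = x), p ω

/-- Shannon entropy of the random variable `X` under the probability mass function `p`. -/
def H (p : Ω → ℝ) {α : Type*} (X : Ω → α) : ℝ :=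
  -∑ ω, p ω * Real.log (pm p X (X ω))

/-- An `(n = d+1, d)` code: messages `M 1, …, M d`, a key `K`, node contents
`W 1, …, W (d+1)`, and repair data `S i j` (data downloaded from node `i` to repair
node `j`), all random variables on a common finite probability space `(Ω, p)`.
The messages are mutually independent, the key is independent of the messages,
each `W i` is a deterministic function of the messages and the key, and each
`S i j` is a deterministic function of `W i`. -/
structure Code (Ω V : Type) [Fintype Ω] (d : ℕ) : Type where
  p : Ω → ℝ
  p_nonneg : ∀ ω, 0 ≤ p ω
  p_sum : ∑ ω, p ω = 1
  M : ℕ → Ω → V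
  K : Ω → V
  W : ℕ → Ω → V
  S : ℕ → ℕ → Ω → V
  M_indep : ∀ x : ℕ → V,
    pm p (fun ω (i : Fin d) => M (↑i + 1) ω) (fun i => x (↑i + 1)) =
      ∏ i ∈ Finset.Icc 1 d, pm p (M i) (x i)
  K_indep : ∀ (k : V) (x : ℕ → V),
    pm p (fun ω => (K ω, fun (i : Fin d) => M (↑i + 1) ω)) (k, fun i => x (↑i + 1)) =
      pm p K k * pm p (fun ω (i : Fin d) => M (↑i + 1) ω) (fun i => x (↑i + 1))
  W_func : ∀ i ∈ Finset.Icc 1 (d + 1),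
    IsFuncOf (W i) (fun ω => ((fun (j : Fin d) => M (↑j + 1) ω), K ω))
  S_func : ∀ i ∈ Finset.Icc 1 (d + 1), ∀ j ∈ Finset.Icc 1 (d + 1), i ≠ j →
    IsFuncOf (S i j) (W i)

/-- Descriptors for the basic random variables of a code. -/
inductive Atom where
  | M : ℕ → Atom
  | K : Atom
  | W : ℕ → Atom
  | S : ℕ → ℕ → Atom

variable {d : ℕ}

/-- The random variable described by an atom. -/
def Code.atomRV (C : Code Ω V d) : Atom → Ω → V
  | .M i => C.M i
  | .K => C.K
  | .W i => C.W i
  | .S i j => C.S i j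

/-- The joint random variable (tuple) described by a list of atoms. -/
def Code.rv (C : Code Ω V d) (L : List Atom) : Ω → List V :=
  fun ω => L.map fun a => C.atomRV a ω

/-- Joint entropy of a tuple of basic random variables. -/
def Code.HL (C : Code Ω V d) (L : List Atom) : ℝ := H C.p (C.rv L)

/-- Conditional entropy `H(L₁ | L₂)`. -/
def Code.CH (C : Code Ω V d) (L₁ L₂ : List Atom) : ℝ := C.HL (L₁ ++ L₂) - C.HL L₂

/-- Mutual information `I(L₁ ; L₂)`. -/
def Code.MI (C : Code Ω V d) (L₁ L₂ : List Atom) : ℝ :=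
  C.HL L₁ + C.HL L₂ - C.HL (L₁ ++ L₂)

/-- Relabeling of an atom along a permutation of the storage-node indices. -/
def Atom.perm (π : Equiv.Perm ℕ) : Atom → Atom
  | .M i => .M i
  | .K => .K
  | .W i => .W (π i)
  | .S i j => .S (π i) (π j)

/-- A code is symmetrical if every joint entropy of a tuple of the basic random
variables is invariant under every permutation of the storage-node indices `[1:n]`. -/
def Code.Symmetrical (C : Code Ω V d) : Prop :=
  ∀ π : Equiv.Perm ℕ, (∀ i ∈ Finset.Icc 1 (d + 1), π i ∈ Finset.Icc 1 (d + 1)) →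
    ∀ L : List Atom, C.HL (L.map (Atom.perm π)) = C.HL L

/-- The list `[a, a+1, …, b]`. -/
def icc (a b : ℕ) : List ℕ := List.range' a (b + 1 - a)

/-- `W_A` as a list of atoms. -/
def Ws (A : List ℕ) : List Atom := A.map Atom.W

/-- `M_A` as a list of atoms. -/
def MsL (A : List ℕ) : List Atom := A.map Atom.M

/-- `M^{(m)} = (M_1, …, M_m)`. -/
def Mup (m : ℕ) : List Atom := MsL (icc 1 m)

/-- `S_{B → j}`. -/
def Sto (B : List ℕ) (j : ℕ) : List Atom := B.map fun i => Atom.S i j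

/-- `S_{i → B}`. -/
def Sfrom (i : ℕ) (B : List ℕ) : List Atom := B.map fun j => Atom.S i j

/-- `S̄_{→ j} = S_{[j+1:n] → j}` (here `n = d+1`). -/
def SbarTo (d j : ℕ) : List Atom := Sto (icc (j + 1) (d + 1)) j

/-- `S̄_{→ A}`. -/
def SbarToL (d : ℕ) (A : List ℕ) : List Atom := (A.map (SbarTo d)).flatten

/-- `S̲_{→ j} = S_{[1:j-1] → j}`. -/
def SunderTo (j : ℕ) : List Atom := Sto (icc 1 (j - 1)) j

/-- `S̲_{→ A}`. -/
def SunderToL (A : List ℕ) : List Atom := (A.map SunderTo).flatten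

/-- `S_{→ j} = S_{([1:n] ∖ {j}) → j}` (here `n = d+1`). -/
def StoFull (d j : ℕ) : List Atom := Sto ((icc 1 (d + 1)).filter (fun i => i ≠ j)) j

/-- `(S_{→ j} : j ∈ A)`. -/
def StoFullL (d : ℕ) (A : List ℕ) : List Atom := (A.map (StoFull d)).flatten

/-- `U^{(t,s)} = (W_{[1:t]}, S̄_{→[t+1:s]})`. -/
def U (d t s : ℕ) : List Atom := Ws (icc 1 t) ++ SbarToL d (icc (t + 1) s)

/-- Node regeneration: each `W j` is a deterministic function of `S_{→ j}`. -/
def Code.NodeRegen (C : Code Ω V d) : Prop :=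
  ∀ j ∈ Finset.Icc 1 (d + 1), IsFuncOf (C.W j) (C.rv (StoFull d j))

/-- Message recovery for parameter `ℓ`: `M j` is constant for `j ∈ [1:ℓ]`, and for every
`A ⊆ [1:n]` with `|A| ∈ [ℓ+1:d]`, `M_{|A|}` is a deterministic function of `W_A`. -/
def Code.MsgRecovery (C : Code Ω V d) (ℓ : ℕ) : Prop :=
  (∀ j ∈ Finset.Icc 1 ℓ, ∃ c : V, ∀ ω, C.M j ω = c) ∧
  ∀ A : Finset ℕ, A ⊆ Finset.Icc 1 (d + 1) → A.card ∈ Finset.Icc (ℓ + 1) d →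
    IsFuncOf (C.M A.card) (C.rv (Ws (A.sort (· ≤ ·))))

/-- Repair secrecy for parameters `ℓ₁, ℓ₂`: for all disjoint `E₁, E₂ ⊆ [1:n]` with
`|E₁| = ℓ₁`, `|E₂| = ℓ₂`, the messages `M_{ℓ+1}, …, M_d` are independent of
`((W_i : i ∈ E₁), (S_{→j} : j ∈ E₂))`, where `ℓ = ℓ₁ + ℓ₂`. -/
def Code.RepairSecrecy (C : Code Ω V d) (ℓ₁ ℓ₂ : ℕ) : Prop :=
  ∀ E₁ E₂ : Finset ℕ, E₁ ⊆ Finset.Icc 1 (d + 1) → E₂ ⊆ Finset.Icc 1 (d + 1) →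
    Disjoint E₁ E₂ → E₁.card = ℓ₁ → E₂.card = ℓ₂ →
    C.MI (MsL (icc (ℓ₁ + ℓ₂ + 1) d))
      (Ws (E₁.sort (· ≤ ·)) ++ StoFullL d (E₂.sort (· ≤ ·))) = 0

/-- `T_{d,k,ℓ} = Σ_{t=ℓ+1}^{k} (d+1−t)`, as a real number. -/
def T (d k ℓ : ℕ) : ℝ := ∑ t ∈ Finset.Icc (ℓ + 1) k, ((d : ℝ) + 1 - (t : ℝ))

section Entropy

variable {α γ δ ε : Type*}

theorem pm_nonneg {p : Ω → ℝ} (hp : ∀ ω, 0 ≤ p ω) (X : Ω → α) (x : α) : 0 ≤ pm p X x :=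
  Finset.sum_nonneg fun ω _ => hp ω

theorem le_pm_self {p : Ω → ℝ} (hp : ∀ ω, 0 ≤ p ω) (X : Ω → α) (ω : Ω) :
    p ω ≤ pm p X (X ω) :=
  Finset.single_le_sum (f := p) (fun ω _ => hp ω) (by simp)

theorem pm_le_pm {p : Ω → ℝ} (hp : ∀ ω, 0 ≤ p ω) {X : Ω → α} {Y : Ω → γ} {ω : Ω}
    (h : ∀ ω', Y ω' = Y ω → X ω' = X ω) : pm p Y (Y ω) ≤ pm p X (X ω) := by
  refine Finset.sum_le_sum_of_subset_of_nonneg ?_ fun ω _ _ => hp ω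
  intro ω'
  simpa using h ω'

theorem H_nonneg {p : Ω → ℝ} (hp : ∀ ω, 0 ≤ p ω) (hp1 : ∑ ω, p ω = 1) (X : Ω → α) :
    0 ≤ H p X := by
  rw [H, ← Finset.sum_neg_distrib]
  refine Finset.sum_nonneg fun ω _ => ?_
  have h1 : pm p X (X ω) ≤ 1 := hp1 ▸
    Finset.sum_le_sum_of_subset_of_nonneg (Finset.filter_subset _ _) fun ω _ _ => hp ω
  have h2 := Real.log_nonpos (pm_nonneg hp X (X ω)) h1
  nlinarith [hp ω]

/-- Entropy is monotone with respect to refinement of the induced partition. -/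
theorem H_mono {p : Ω → ℝ} (hp : ∀ ω, 0 ≤ p ω) {X : Ω → α} {Y : Ω → γ}
    (h : ∀ ω ω', Y ω = Y ω' → X ω = X ω') : H p X ≤ H p Y := by
  rw [H, H]
  refine neg_le_neg (Finset.sum_le_sum fun ω _ => ?_)
  rcases (hp ω).eq_or_lt with h0 | h0
  · simp [← h0]
  · exact mul_le_mul_of_nonneg_left (Real.log_le_log (h0.trans_le (le_pm_self hp Y ω))
      (pm_le_pm hp fun ω' => h ω' ω)) h0.le

theorem sum_ite_div_pm_le_one {p : Ω → ℝ} (hp : ∀ ω, 0 ≤ p ω) (J : Ω → α) (P : Ω → Prop)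
    [DecidablePred P] (h : ∀ ω ω', P ω → P ω' → J ω = J ω') :
    ∑ ω, (if P ω then p ω / pm p J (J ω) else 0) ≤ 1 := by
  by_cases hP : ∃ ω₀, P ω₀
  · obtain ⟨ω₀, h₀⟩ := hP
    calc ∑ ω, (if P ω then p ω / pm p J (J ω) else 0)
        ≤ ∑ ω, (if J ω = J ω₀ then p ω / pm p J (J ω₀) else 0) := by
          refine Finset.sum_le_sum fun ω _ => ?_
          by_cases hω : P ω
          · simp [hω, h ω ω₀ hω h₀]
          · simp only [hω, if_false]
            split_ifs
            · exact div_nonneg (hp ω) (pm_nonneg hp _ _)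
            · exact le_rfl
      _ = pm p J (J ω₀) / pm p J (J ω₀) := by
          rw [← Finset.sum_filter, ← Finset.sum_div, pm]
      _ ≤ 1 := div_self_le_one _
  · push Not at hP
    simp [hP]

theorem sum_mul_pm_ratio_le_one {p : Ω → ℝ} (hp : ∀ ω, 0 ≤ p ω) (hp1 : ∑ ω, p ω = 1)
    {J : Ω → α} {Z : Ω → γ} {X : Ω → δ} {Y : Ω → ε}
    (hJ : ∀ ω ω', X ω = X ω' → Y ω = Y ω' → J ω = J ω')
    (hX : ∀ ω ω', X ω = X ω' → Z ω = Z ω') (hY : ∀ ω ω', Y ω = Y ω' → Z ω = Z ω') :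
    ∑ ω, p ω * (pm p X (X ω) * pm p Y (Y ω) / (pm p J (J ω) * pm p Z (Z ω))) ≤ 1 := by
  have expand : ∀ ω, p ω * (pm p X (X ω) * pm p Y (Y ω) / (pm p J (J ω) * pm p Z (Z ω))) =
      ∑ u, ∑ v, p u * (if Z v = Z u then p v / pm p Z (Z v) else 0) *
        (if X ω = X u ∧ Y ω = Y v then p ω / pm p J (J ω) else 0) := by
    intro ω
    have e : pm p X (X ω) * pm p Y (Y ω) =
        ∑ u, ∑ v, (if X u = X ω then p u else 0) * (if Y v = Y ω then p v else 0) := by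
      rw [pm, pm, Finset.sum_filter, Finset.sum_filter, Finset.sum_mul_sum]
    rw [e, mul_div_assoc', Finset.mul_sum, Finset.sum_div]
    refine Finset.sum_congr rfl fun u _ => ?_
    rw [Finset.mul_sum, Finset.sum_div]
    refine Finset.sum_congr rfl fun v _ => ?_
    by_cases h1 : X ω = X u
    · by_cases h2 : Y ω = Y v
      · have h3 : Z v = Z ω := (hY _ _ h2).symm
        have h4 : Z ω = Z u := hX _ _ h1
        simp only [h1, h2, h3, h4, and_self, if_true]
        ring
      · simp [h2, Ne.symm h2]
    · simp [h1, Ne.symm h1]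
  simp_rw [expand]
  rw [Finset.sum_comm]
  refine le_trans (Finset.sum_le_sum (g := p) fun u _ => ?_) hp1.le
  rw [Finset.sum_comm]
  simp_rw [← Finset.mul_sum]
  calc ∑ v, p u * (if Z v = Z u then p v / pm p Z (Z v) else 0) *
          ∑ ω, (if X ω = X u ∧ Y ω = Y v then p ω / pm p J (J ω) else 0)
      ≤ ∑ v, p u * (if Z v = Z u then p v / pm p Z (Z v) else 0) := by
        refine Finset.sum_le_sum fun v _ => mul_le_of_le_one_right (mul_nonneg (hp u) ?_) ?_
        · split_ifs
          · exact div_nonneg (hp v) (pm_nonneg hp _ _)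
          · exact le_rfl
        · exact sum_ite_div_pm_le_one hp J (fun ω => X ω = X u ∧ Y ω = Y v) fun ω ω' h h' =>
            hJ _ _ (h.1.trans h'.1.symm) (h.2.trans h'.2.symm)
    _ = p u * ∑ v, (if Z v = Z u then p v / pm p Z (Z v) else 0) := by rw [Finset.mul_sum]
    _ ≤ p u := mul_le_of_le_one_right (hp u)
        (sum_ite_div_pm_le_one hp Z _ fun ω ω' h h' => h.trans h'.symm)

/-- Submodularity of entropy: if `J` is a function of `(X, Y)` and `Z` is both a function of `X`
and a function of `Y`, then `H(J) + H(Z) ≤ H(X) + H(Y)`. -/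
theorem H_submodular {p : Ω → ℝ} (hp : ∀ ω, 0 ≤ p ω) (hp1 : ∑ ω, p ω = 1)
    {J : Ω → α} {Z : Ω → γ} {X : Ω → δ} {Y : Ω → ε}
    (hJ : ∀ ω ω', X ω = X ω' → Y ω = Y ω' → J ω = J ω')
    (hX : ∀ ω ω', X ω = X ω' → Z ω = Z ω') (hY : ∀ ω ω', Y ω = Y ω' → Z ω = Z ω') :
    H p J + H p Z ≤ H p X + H p Y := by
  have hratio := sum_mul_pm_ratio_le_one hp hp1 hJ hX hY
  have key : ∑ ω, p ω * (Real.log (pm p X (X ω)) + Real.log (pm p Y (Y ω)) -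
      Real.log (pm p J (J ω)) - Real.log (pm p Z (Z ω))) ≤
      ∑ ω, (p ω * (pm p X (X ω) * pm p Y (Y ω) / (pm p J (J ω) * pm p Z (Z ω))) - p ω) := by
    refine Finset.sum_le_sum fun ω _ => ?_
    rcases (hp ω).eq_or_lt with h0 | h0
    · simp [← h0]
    · have hx := h0.trans_le (le_pm_self hp X ω)
      have hy := h0.trans_le (le_pm_self hp Y ω)
      have hj := h0.trans_le (le_pm_self hp J ω)
      have hz := h0.trans_le (le_pm_self hp Z ω)
      have hlog := Real.log_le_sub_one_of_pos (div_pos (mul_pos hx hy) (mul_pos hj hz))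
      rw [Real.log_div (by positivity) (by positivity), Real.log_mul hx.ne' hy.ne',
        Real.log_mul hj.ne' hz.ne'] at hlog
      nlinarith
  rw [Finset.sum_sub_distrib, hp1] at key
  simp only [mul_sub, mul_add, Finset.sum_sub_distrib, Finset.sum_add_distrib] at key
  simp only [H]
  linarith

end Entropy

namespace Code

/-- Joint entropy of a set of basic random variables. -/
def ent (C : Code Ω V d) (A : Set Atom) : ℝ := H C.p (fun ω (a : A) => C.atomRV a ω)

/-- The random variables in `A` determine those in `B`. -/
def Determines (C : Code Ω V d) (A B : Set Atom) : Prop :=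
  ∀ ω ω', (∀ a ∈ A, C.atomRV a ω = C.atomRV a ω') → ∀ b ∈ B, C.atomRV b ω = C.atomRV b ω'

theorem restrict_eq_iff (C : Code Ω V d) (A : Set Atom) (ω ω' : Ω) :
    ((fun a : A => C.atomRV a ω) = fun a : A => C.atomRV a ω') ↔
      ∀ a ∈ A, C.atomRV a ω = C.atomRV a ω' := by
  simp [funext_iff]

theorem rv_eq_iff (C : Code Ω V d) (L : List Atom) (ω ω' : Ω) :
    C.rv L ω = C.rv L ω' ↔ ∀ a ∈ L, C.atomRV a ω = C.atomRV a ω' := by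
  simp [rv]

theorem HL_eq_ent (C : Code Ω V d) (L : List Atom) : C.HL L = C.ent {a | a ∈ L} := by
  refine le_antisymm (H_mono C.p_nonneg fun ω ω' h => ?_) (H_mono C.p_nonneg fun ω ω' h => ?_)
  · exact (C.rv_eq_iff L ω ω').2 ((C.restrict_eq_iff _ ω ω').1 h)
  · exact (C.restrict_eq_iff _ ω ω').2 ((C.rv_eq_iff L ω ω').1 h)

theorem HL_singleton (C : Code Ω V d) (a : Atom) : C.HL [a] = C.ent {a} := by
  rw [HL_eq_ent]
  simp

theorem ent_nonneg (C : Code Ω V d) (A : Set Atom) : 0 ≤ C.ent A :=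
  H_nonneg C.p_nonneg C.p_sum _

theorem Determines.of_subset (C : Code Ω V d) {A B : Set Atom} (h : B ⊆ A) :
    C.Determines A B := fun _ _ hA b hb => hA b (h hb)

theorem Determines.ent_le {C : Code Ω V d} {A B : Set Atom} (h : C.Determines A B) :
    C.ent B ≤ C.ent A :=
  H_mono C.p_nonneg fun ω ω' hA =>
    (C.restrict_eq_iff _ ω ω').2 (h ω ω' ((C.restrict_eq_iff _ ω ω').1 hA))

theorem ent_union_add_le (C : Code Ω V d) {A B Z : Set Atom} (hA : C.Determines A Z)
    (hB : C.Determines B Z) : C.ent (A ∪ B) + C.ent Z ≤ C.ent A + C.ent B := by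
  refine H_submodular C.p_nonneg C.p_sum ?_ ?_ ?_ <;> intro ω ω' <;>
    simp only [restrict_eq_iff]
  · rintro h h' a (ha | ha)
    exacts [h a ha, h' a ha]
  · exact hA ω ω'
  · exact hB ω ω'

theorem ent_union_le (C : Code Ω V d) (A B : Set Atom) :
    C.ent (A ∪ B) ≤ C.ent A + C.ent B := by
  have h := C.ent_union_add_le (A := A) (B := B) (Z := ∅) (fun _ _ _ _ h => h.elim)
    (fun _ _ _ _ h => h.elim)
  linarith [C.ent_nonneg ∅]

theorem ent_union_image_le (C : Code Ω V d) (A : Set Atom) (f : ℕ → Atom) (s : Finset ℕ)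
    (c : ℕ → ℝ) (h : ∀ i ∈ s, C.ent (A ∪ {f i}) ≤ C.ent A + c i) :
    C.ent (A ∪ f '' s) ≤ C.ent A + ∑ i ∈ s, c i := by
  induction s using Finset.induction_on with
  | empty => simp
  | insert i s hi ih =>
    have ih := ih fun j hj => h j (Finset.mem_insert_of_mem hj)
    have hi' := h i (Finset.mem_insert_self i s)
    have hs := C.ent_union_add_le (A := A ∪ f '' s) (B := A ∪ {f i}) (Z := A)
      (.of_subset C Set.subset_union_left) (.of_subset C Set.subset_union_left)
    have e : A ∪ f '' (insert i s : Finset ℕ) = A ∪ f '' s ∪ (A ∪ {f i}) := by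
      rw [Finset.coe_insert, Set.image_insert_eq]
      ext x
      simp only [Set.mem_union, Set.mem_insert_iff, Set.mem_singleton_iff]
      tauto
    rw [e, Finset.sum_insert hi]
    linarith

theorem ent_eq_of_swap {C : Code Ω V d} (hsym : C.Symmetrical) {a b : ℕ}
    (ha : a ∈ Finset.Icc 1 (d + 1)) (hb : b ∈ Finset.Icc 1 (d + 1)) {A B : Set Atom}
    (hA : A.Finite) (h : ∀ x, x ∈ B ↔ x.perm (Equiv.swap a b) ∈ A) : C.ent B = C.ent A := by
  have hinv : ∀ x : Atom, (x.perm (Equiv.swap a b)).perm (Equiv.swap a b) = x := by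
    rintro (_ | _ | _ | _) <;> simp [Atom.perm]
  have hπ : ∀ i ∈ Finset.Icc 1 (d + 1), Equiv.swap a b i ∈ Finset.Icc 1 (d + 1) := by
    intro i hi
    rw [Equiv.swap_apply_def]
    split_ifs <;> assumption
  have hL := hsym _ hπ hA.toFinset.toList
  rw [HL_eq_ent, HL_eq_ent] at hL
  convert hL using 2
  · ext x
    simp only [h, List.mem_map, Finset.mem_toList, Set.Finite.mem_toFinset, Set.mem_ofPred_eq]
    exact ⟨fun hx => ⟨_, hx, hinv x⟩, fun ⟨y, hy, hyx⟩ => by rwa [← hyx, hinv]⟩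
  · ext x
    simp

end Code

/-- The messages `M_{ℓ+1}, …, M_m`, the contents of the first `t` nodes, and all data for the
repair of the nodes `k+1, …, t`. -/
def knowledge (d k ℓ m t : ℕ) : Set Atom := {x | match x with
  | .M j => ℓ < j ∧ j ≤ m
  | .K => False
  | .W j => 1 ≤ j ∧ j ≤ t
  | .S i j => 1 ≤ i ∧ i ≤ d + 1 ∧ k < j ∧ j ≤ t ∧ i ≠ j}

theorem finite_knowledge (d k ℓ m t : ℕ) : (knowledge d k ℓ m t).Finite := by
  refine (((Set.finite_Iic m).image Atom.M).union (((Set.finite_Iic t).image Atom.W).union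
    (((Set.finite_Iic (d + 1)).prod (Set.finite_Iic t)).image fun q => Atom.S q.1 q.2))).subset ?_
  rintro (j | _ | j | ⟨i, j⟩) h
  · exact Or.inl ⟨j, h.2, rfl⟩
  · exact h.elim
  · exact Or.inr (Or.inl ⟨j, h.2, rfl⟩)
  · exact Or.inr (Or.inr ⟨(i, j), ⟨h.2.1, h.2.2.2.1⟩, rfl⟩)

theorem knowledge_mono {d k ℓ m m' t t' : ℕ} (hm : m ≤ m') (ht : t ≤ t') :
    knowledge d k ℓ m t ⊆ knowledge d k ℓ m' t' := by
  rintro (j | _ | j | ⟨i, j⟩) h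
  · exact ⟨h.1, h.2.trans hm⟩
  · exact h.elim
  · exact ⟨h.1, h.2.trans ht⟩
  · exact ⟨h.1, h.2.1, h.2.2.1, h.2.2.2.1.trans ht, h.2.2.2.2⟩

theorem mem_repair_iff {a b t : ℕ} (x : Atom) :
    x ∈ (fun i => Atom.S i t) '' Finset.Ioc a b ↔ match x with
      | .S i j => (a < i ∧ i ≤ b) ∧ j = t
      | _ => False := by
  rcases x with _ | _ | _ | ⟨i, j⟩
  · simp
  · simp
  · simp
  · simp [eq_comm]

theorem mem_icc {a b i : ℕ} : i ∈ icc a b ↔ a ≤ i ∧ i ≤ b := by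
  simp only [icc, List.mem_range'_1]
  omega

namespace Code

theorem W_eq_of_repair {C : Code Ω V d} (hregen : C.NodeRegen) {ω ω' : Ω} {j : ℕ}
    (hj : j ∈ Finset.Icc 1 (d + 1))
    (h : ∀ i, 1 ≤ i → i ≤ d + 1 → i ≠ j → C.S i j ω = C.S i j ω') : C.W j ω = C.W j ω' := by
  obtain ⟨f, hf⟩ := hregen j hj
  rw [hf, hf, (C.rv_eq_iff _ ω ω').2]
  intro a ha
  simp only [StoFull, Sto, List.mem_map, List.mem_filter, mem_icc, decide_eq_true_eq] at ha
  obtain ⟨i, ⟨⟨h1, h2⟩, h3⟩, rfl⟩ := ha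
  exact h i h1 h2 h3

theorem S_eq_of_W_eq (C : Code Ω V d) {ω ω' : Ω} {i j : ℕ} (hi : i ∈ Finset.Icc 1 (d + 1))
    (hj : j ∈ Finset.Icc 1 (d + 1)) (hij : i ≠ j) (h : C.W i ω = C.W i ω') :
    C.S i j ω = C.S i j ω' := by
  obtain ⟨f, hf⟩ := C.S_func i hi j hj hij
  rw [hf, hf, h]

/-- Adding the data sent to node `t` by the later nodes reveals everything about node `t`. -/
theorem ent_knowledge_union_repair {C : Code Ω V d} (hregen : C.NodeRegen) {k ℓ m t : ℕ}
    (hk : k ≤ t) (ht : t ≤ d) :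
    C.ent (knowledge d k ℓ m t ∪ (fun i => Atom.S i (t + 1)) '' Finset.Ioc (t + 1) (d + 1)) =
      C.ent (knowledge d k ℓ m (t + 1)) := by
  refine le_antisymm (Determines.of_subset C ?_).ent_le (Determines.ent_le ?_)
  · refine Set.union_subset (knowledge_mono le_rfl t.le_succ) ?_
    rintro _ ⟨i, hi, rfl⟩
    simp only [Finset.coe_Ioc, Set.mem_Ioc] at hi
    exact ⟨by omega, by omega, by omega, by omega, by omega⟩
  · intro ω ω' h
    have hS : ∀ i, 1 ≤ i → i ≤ d + 1 → i ≠ t + 1 → C.S i (t + 1) ω = C.S i (t + 1) ω' := by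
      intro i h1 h2 h3
      by_cases hit : i ≤ t
      · exact C.S_eq_of_W_eq (by simp; omega) (by simp; omega) h3
          (h (.W i) (Or.inl ⟨h1, hit⟩))
      · exact h (.S i (t + 1)) (Or.inr ⟨i, by simp; omega, rfl⟩)
    rintro (j | _ | j | ⟨i, j⟩) hx
    · exact h _ (Or.inl hx)
    · exact hx.elim
    · by_cases hjt : j ≤ t
      · exact h (.W j) (Or.inl ⟨hx.1, hjt⟩)
      · obtain rfl : j = t + 1 := le_antisymm hx.2 (by omega)
        exact W_eq_of_repair hregen (by simp; omega) hS
    · obtain ⟨h1, h2, h3, h4, h5⟩ := hx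
      by_cases hjt : j ≤ t
      · exact h (.S i j) (Or.inl ⟨h1, h2, h3, hjt, h5⟩)
      · obtain rfl : j = t + 1 := le_antisymm h4 (by omega)
        exact hS i h1 h2 h5

/-- Exchange inequality between the entropy increments of consecutive nodes. -/
theorem increment_exchange {C : Code Ω V d} (hsym : C.Symmetrical) (hregen : C.NodeRegen)
    {k ℓ m t : ℕ} (hk : k ≤ t) (ht : t + 1 ≤ d) :
    ((d : ℝ) - t) * (C.ent (knowledge d k ℓ m (t + 2)) - C.ent (knowledge d k ℓ m (t + 1))) ≤
      ((d : ℝ) - t - 1) *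
        (C.ent (knowledge d k ℓ m (t + 1)) - C.ent (knowledge d k ℓ m t)) := by
  have e1 := ent_knowledge_union_repair hregen (ℓ := ℓ) (m := m) hk (by omega : t ≤ d)
  have e2 := ent_knowledge_union_repair hregen (k := k) (ℓ := ℓ) (m := m)
    (by omega : k ≤ t + 1) ht
  have mem1 : t + 1 ∈ Finset.Icc 1 (d + 1) := by simp; omega
  have mem2 : t + 2 ∈ Finset.Icc 1 (d + 1) := by simp; omega
  set B := knowledge d k ℓ m t with hB
  set x := C.ent (B ∪ {Atom.S (t + 2) (t + 1)}) - C.ent B with hx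
  have fin : ∀ s : Set Atom, s.Finite → (B ∪ s).Finite := fun s hs =>
    (finite_knowledge d k ℓ m t).union hs
  have subadd : C.ent (knowledge d k ℓ m (t + 1)) ≤ C.ent B + (d - t) * x := by
    rw [← e1]
    refine (C.ent_union_image_le B _ _ (fun _ => x) fun i hi => ?_).trans_eq ?_
    · rw [hx, add_sub_cancel]
      simp only [Finset.mem_Ioc] at hi
      refine (ent_eq_of_swap hsym (a := i) (b := t + 2) (by simp; omega) mem2
        (fin _ (Set.finite_singleton _)) ?_).le
      rintro (j | _ | j | ⟨i', j⟩) <;>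
        simp only [hB, knowledge, Set.mem_union, Set.mem_ofPred_eq, Set.mem_singleton_iff,
          Atom.perm, Atom.S.injEq, reduceCtorEq, or_false, Equiv.swap_apply_def] <;>
        split_ifs <;> omega
    · have : ((d + 1 - (t + 1) : ℕ) : ℝ) = d - t := by
        rw [Nat.add_sub_add_right, Nat.cast_sub (by omega)]
      rw [Finset.sum_const, Nat.card_Ioc, nsmul_eq_mul, this]
  have swap1 : C.ent (B ∪ {Atom.S (t + 1) (t + 2)}) = C.ent (B ∪ {Atom.S (t + 2) (t + 1)}) := by
    refine ent_eq_of_swap hsym mem1 mem2 (fin _ (Set.finite_singleton _)) ?_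
    rintro (j | _ | j | ⟨i', j⟩) <;>
      simp only [hB, knowledge, Set.mem_union, Set.mem_ofPred_eq, Set.mem_singleton_iff,
        Atom.perm, Atom.S.injEq, reduceCtorEq, or_false, Equiv.swap_apply_def] <;>
      split_ifs <;> omega
  have swap2 : C.ent (B ∪ {Atom.S (t + 1) (t + 2)} ∪
      (fun i => Atom.S i (t + 2)) '' Finset.Ioc (t + 2) (d + 1)) =
      C.ent (B ∪ (fun i => Atom.S i (t + 1)) '' Finset.Ioc (t + 1) (d + 1)) := by
    refine ent_eq_of_swap hsym mem1 mem2 (fin _ ((Finset.finite_toSet _).image _)) ?_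
    rintro (j | _ | j | ⟨i', j⟩) <;>
      simp only [hB, knowledge, Set.mem_union, Set.mem_ofPred_eq, Set.mem_singleton_iff,
        Atom.perm, mem_repair_iff, Atom.S.injEq, reduceCtorEq, or_false, Equiv.swap_apply_def] <;>
      split_ifs <;> omega
  have det : C.Determines (knowledge d k ℓ m (t + 1)) (B ∪ {Atom.S (t + 1) (t + 2)}) := by
    intro ω ω' h b hb
    rcases hb with hb | rfl
    · exact h b (knowledge_mono le_rfl t.le_succ hb)
    · exact C.S_eq_of_W_eq mem1 mem2 (by omega)
        (h (.W (t + 1)) ⟨by omega, le_rfl⟩)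
  have sub := C.ent_union_add_le (B := B ∪ {Atom.S (t + 1) (t + 2)} ∪
      (fun i => Atom.S i (t + 2)) '' Finset.Ioc (t + 2) (d + 1)) det
      (.of_subset C Set.subset_union_left)
  have up : C.ent (knowledge d k ℓ m (t + 2)) ≤ C.ent (knowledge d k ℓ m (t + 1) ∪
      (B ∪ {Atom.S (t + 1) (t + 2)} ∪
        (fun i => Atom.S i (t + 2)) '' Finset.Ioc (t + 2) (d + 1))) := by
    rw [← e2]
    refine (Determines.of_subset C ?_).ent_le
    exact Set.union_subset_union_right _ Set.subset_union_right
  have step : C.ent (knowledge d k ℓ m (t + 2)) - C.ent (knowledge d k ℓ m (t + 1)) ≤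
      C.ent (knowledge d k ℓ m (t + 1)) - C.ent B - x := by
    linarith
  have hdt : (0 : ℝ) ≤ (d : ℝ) - t := by
    have : (t : ℝ) + 1 ≤ d := by exact_mod_cast ht
    linarith
  nlinarith [mul_le_mul_of_nonneg_left step hdt]

/-- Recovering `M_m` from the first `m` nodes. -/
theorem ent_knowledge_recover {C : Code Ω V d} {k ℓ m : ℕ} (hrec : C.MsgRecovery ℓ)
    (hℓ : ℓ ≤ m) (hm : m + 1 ≤ d) :
    C.ent (knowledge d k ℓ (m + 1) (m + 1)) = C.ent (knowledge d k ℓ m (m + 1)) := by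
  refine le_antisymm (Determines.ent_le ?_)
    (Determines.of_subset C (knowledge_mono m.le_succ le_rfl)).ent_le
  intro ω ω' h
  rintro (j | _ | j | ⟨i, j⟩) hx
  · by_cases hj : j ≤ m
    · exact h (.M j) ⟨hx.1, hj⟩
    · obtain rfl : j = m + 1 := le_antisymm hx.2 (by omega)
      obtain ⟨f, hf⟩ := hrec.2 (Finset.Icc 1 (m + 1))
        (Finset.Icc_subset_Icc le_rfl (by omega)) (by simp; omega)
      rw [Nat.card_Icc, Nat.add_sub_cancel] at hf
      change C.M (m + 1) ω = C.M (m + 1) ω'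
      rw [hf, hf, (C.rv_eq_iff _ ω ω').2]
      intro a ha
      simp only [Ws, List.mem_map, Finset.mem_sort, Finset.mem_Icc] at ha
      obtain ⟨i, hi, rfl⟩ := ha
      exact h (.W i) hi
  · exact hx.elim
  · exact h (.W j) hx
  · exact h (.S i j) hx

/-- The joint entropy of the mutually independent messages. -/
theorem ent_messages (C : Code Ω V d) :
    C.ent (Atom.M '' Finset.Icc 1 d) = ∑ j ∈ Finset.Icc 1 d, C.ent {Atom.M j} := by
  have joint : C.ent (Atom.M '' Finset.Icc 1 d) = H C.p (fun ω (i : Fin d) => C.M (i + 1) ω) := by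
    refine le_antisymm (H_mono C.p_nonneg fun ω ω' h => ?_) (H_mono C.p_nonneg fun ω ω' h => ?_)
    · rw [restrict_eq_iff]
      rintro _ ⟨j, hj, rfl⟩
      simp only [Finset.coe_Icc, Set.mem_Icc] at hj
      have := congrFun h ⟨j - 1, by omega⟩
      simpa [atomRV, Nat.sub_add_cancel hj.1] using this
    · rw [restrict_eq_iff] at h
      funext i
      exact h (.M (i + 1)) ⟨i + 1, by simp, rfl⟩
  have single : ∀ j, C.ent {Atom.M j} = H C.p (C.M j) := by
    intro j
    refine le_antisymm (H_mono C.p_nonneg fun ω ω' h => ?_) (H_mono C.p_nonneg fun ω ω' h => ?_)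
    · rw [restrict_eq_iff]
      rintro _ rfl
      exact h
    · rw [restrict_eq_iff] at h
      exact h _ rfl
  simp_rw [joint, single, H]
  rw [Finset.sum_neg_distrib, Finset.sum_comm]
  congr 1
  refine Finset.sum_congr rfl fun ω _ => ?_
  rw [← Finset.mul_sum, C.M_indep fun i => C.M i ω]
  rcases (C.p_nonneg ω).eq_or_lt with h0 | h0
  · simp [← h0]
  · rw [Real.log_prod fun i _ => (h0.trans_le (le_pm_self C.p_nonneg (C.M i) ω)).ne']

/-- Repair secrecy expressed through `knowledge`. -/
theorem secrecy_knowledge {C : Code Ω V d} (hregen : C.NodeRegen) {ℓ₁ ℓ₂ : ℕ}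
    (hℓ : ℓ₁ + ℓ₂ ≤ d) (hsec : C.RepairSecrecy ℓ₁ ℓ₂) :
    C.ent (knowledge d ℓ₁ (ℓ₁ + ℓ₂) d (ℓ₁ + ℓ₂)) =
      C.ent (Atom.M '' Finset.Ioc (ℓ₁ + ℓ₂) d) +
        C.ent (knowledge d ℓ₁ (ℓ₁ + ℓ₂) (ℓ₁ + ℓ₂) (ℓ₁ + ℓ₂)) := by
  have h := hsec (Finset.Icc 1 ℓ₁) (Finset.Ioc ℓ₁ (ℓ₁ + ℓ₂))
    (Finset.Icc_subset_Icc le_rfl (by omega))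
    (by intro i; simp only [Finset.mem_Ioc, Finset.mem_Icc]; omega)
    (by rw [Finset.disjoint_left]; intro i; simp only [Finset.mem_Ioc, Finset.mem_Icc]; omega)
    (by simp) (by simp)
  set L := Ws ((Finset.Icc 1 ℓ₁).sort (· ≤ ·)) ++
    StoFullL d ((Finset.Ioc ℓ₁ (ℓ₁ + ℓ₂)).sort (· ≤ ·)) with hL
  have memL : ∀ a, a ∈ L ↔ (∃ j, (1 ≤ j ∧ j ≤ ℓ₁) ∧ Atom.W j = a) ∨
      ∃ j, (ℓ₁ < j ∧ j ≤ ℓ₁ + ℓ₂) ∧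
        ∃ i, ((1 ≤ i ∧ i ≤ d + 1) ∧ i ≠ j) ∧ Atom.S i j = a := by
    intro a
    simp [hL, Ws, StoFullL, StoFull, Sto, mem_icc]
  have memM : ∀ a, a ∈ MsL (icc (ℓ₁ + ℓ₂ + 1) d) ↔
      ∃ j, (ℓ₁ + ℓ₂ < j ∧ j ≤ d) ∧ Atom.M j = a := by
    intro a
    simp [MsL, mem_icc]
  have eM : C.HL (MsL (icc (ℓ₁ + ℓ₂ + 1) d)) = C.ent (Atom.M '' Finset.Ioc (ℓ₁ + ℓ₂) d) := by
    rw [HL_eq_ent]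
    congr 1
    ext a
    simp [memM]
  have sub : ∀ m, {a | a ∈ L} ⊆ knowledge d ℓ₁ (ℓ₁ + ℓ₂) m (ℓ₁ + ℓ₂) := by
    intro m a ha
    rcases (memL a).1 ha with ⟨j, hj, rfl⟩ | ⟨j, hj, i, hi, rfl⟩
    · exact ⟨hj.1, by omega⟩
    · exact ⟨hi.1.1, hi.1.2, hj.1, hj.2, hi.2⟩
  have det : ∀ ω ω', (∀ a ∈ L, C.atomRV a ω = C.atomRV a ω') →
      ∀ m, ∀ b ∈ knowledge d ℓ₁ (ℓ₁ + ℓ₂) m (ℓ₁ + ℓ₂), (∀ j, b ≠ .M j) →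
        C.atomRV b ω = C.atomRV b ω' := by
    rintro ω ω' hω m (j | _ | j | ⟨i, j⟩) hb hbM
    · exact (hbM j rfl).elim
    · exact hb.elim
    · by_cases hj : j ≤ ℓ₁
      · exact hω _ ((memL _).2 (Or.inl ⟨j, ⟨hb.1, hj⟩, rfl⟩))
      · refine W_eq_of_repair hregen (by simp; exact ⟨hb.1, hb.2.trans (by omega)⟩) ?_
        intro i h1 h2 h3
        exact hω (.S i j) ((memL _).2 (Or.inr
          ⟨j, ⟨by omega, hb.2⟩, i, ⟨⟨h1, h2⟩, h3⟩, rfl⟩))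
    · obtain ⟨h1, h2, h3, h4, h5⟩ := hb
      exact hω (.S i j) ((memL _).2 (Or.inr ⟨j, ⟨h3, h4⟩, i, ⟨⟨h1, h2⟩, h5⟩, rfl⟩))
  have eL : C.HL L = C.ent (knowledge d ℓ₁ (ℓ₁ + ℓ₂) (ℓ₁ + ℓ₂) (ℓ₁ + ℓ₂)) := by
    rw [HL_eq_ent]
    refine le_antisymm (Determines.of_subset C (sub _)).ent_le (Determines.ent_le ?_)
    intro ω ω' hω b hb
    refine det ω ω' hω _ b hb ?_
    rintro j rfl
    exact absurd hb.1 (not_lt.2 hb.2)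
  have eML : C.HL (MsL (icc (ℓ₁ + ℓ₂ + 1) d) ++ L) =
      C.ent (knowledge d ℓ₁ (ℓ₁ + ℓ₂) d (ℓ₁ + ℓ₂)) := by
    rw [HL_eq_ent]
    refine le_antisymm (Determines.of_subset C ?_).ent_le (Determines.ent_le ?_)
    · intro a ha
      rcases List.mem_append.1 ha with ha | ha
      · obtain ⟨j, hj, rfl⟩ := (memM a).1 ha
        exact hj
      · exact sub d ha
    · intro ω ω' hω b hb
      by_cases hbM : ∃ j, b = .M j
      · obtain ⟨j, rfl⟩ := hbM
        exact hω _ (List.mem_append_left _ ((memM _).2 ⟨j, hb, rfl⟩))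
      · push Not at hbM
        exact det ω ω' (fun a ha => hω a (List.mem_append_right _ ha)) _ b hb hbM
  rw [MI, eM, eL, eML] at h
  linarith

theorem ent_knowledge_add_messages_le (C : Code Ω V d) (k ℓ m m' t : ℕ) :
    C.ent (knowledge d k ℓ m' t) ≤
      C.ent (knowledge d k ℓ m t) + ∑ j ∈ Finset.Ioc m m', C.ent {Atom.M j} := by
  refine le_trans (Determines.of_subset C ?_).ent_le
    (C.ent_union_image_le _ Atom.M (Finset.Ioc m m') _ fun i _ => C.ent_union_le _ _)
  rintro (j | _ | j | ⟨i, j⟩) h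
  · by_cases hj : j ≤ m
    · exact Or.inl ⟨h.1, hj⟩
    · exact Or.inr ⟨j, by simpa using ⟨not_le.1 hj, h.2⟩, rfl⟩
  · exact h.elim
  · exact Or.inl h
  · exact Or.inl h

/-- Given the eavesdropped data and the earlier messages, each message retains its entropy. -/
theorem ent_message_le {C : Code Ω V d} (hregen : C.NodeRegen) {ℓ₁ ℓ₂ m : ℕ}
    (hsec : C.RepairSecrecy ℓ₁ ℓ₂) (hm : ℓ₁ + ℓ₂ ≤ m) (hmd : m + 1 ≤ d) :
    C.ent {Atom.M (m + 1)} ≤ C.ent (knowledge d ℓ₁ (ℓ₁ + ℓ₂) (m + 1) (ℓ₁ + ℓ₂)) -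
      C.ent (knowledge d ℓ₁ (ℓ₁ + ℓ₂) m (ℓ₁ + ℓ₂)) := by
  have hs := secrecy_knowledge hregen (by omega) hsec
  set ℓ := ℓ₁ + ℓ₂ with hℓ
  have h1 := C.ent_knowledge_add_messages_le ℓ₁ ℓ (m + 1) d ℓ
  have h2 := C.ent_knowledge_add_messages_le ℓ₁ ℓ ℓ m ℓ
  have h3 := C.ent_union_image_le (Atom.M '' Finset.Ioc ℓ d) Atom.M (Finset.Icc 1 ℓ)
    (fun j => C.ent {Atom.M j}) fun i _ => C.ent_union_le _ _
  have e : (Atom.M '' Finset.Ioc ℓ d) ∪ (Atom.M '' Finset.Icc 1 ℓ) =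
      Atom.M '' Finset.Icc 1 d := by
    rw [← Set.image_union, ← Finset.coe_union]
    congr 2
    ext i
    simp only [Finset.mem_union, Finset.mem_Ioc, Finset.mem_Icc]
    omega
  rw [e, ent_messages] at h3
  have split1 : ∑ j ∈ Finset.Icc 1 d, C.ent {Atom.M j} =
      ∑ j ∈ Finset.Icc 1 ℓ, C.ent {Atom.M j} + ∑ j ∈ Finset.Ioc ℓ d, C.ent {Atom.M j} := by
    rw [← Finset.sum_union]
    · congr 1
      ext i
      simp only [Finset.mem_union, Finset.mem_Ioc, Finset.mem_Icc]
      omega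
    · rw [Finset.disjoint_left]
      intro i
      simp only [Finset.mem_Ioc, Finset.mem_Icc]
      omega
  have split2 := Finset.sum_Ioc_consecutive (fun j => C.ent {Atom.M j}) hm (by omega : m ≤ d)
  have split3 := Finset.sum_Ioc_consecutive (fun j => C.ent {Atom.M j}) m.le_succ hmd
  simp only [Nat.succ_eq_add_one, Nat.Ioc_succ_singleton, Finset.sum_singleton] at split3
  linarith

/-- Repairing the first node beyond the eavesdropped ones takes `d - ℓ` transmissions. -/
theorem ent_first_increment_le {C : Code Ω V d} (hregen : C.NodeRegen) {β : ℝ}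
    (hβ : ∀ i ∈ Finset.Icc 1 (d + 1), ∀ j ∈ Finset.Icc 1 (d + 1), i ≠ j →
      C.HL [Atom.S i j] ≤ β) {k ℓ m : ℕ} (hk : k ≤ ℓ) (hℓ : ℓ ≤ d) :
    C.ent (knowledge d k ℓ m (ℓ + 1)) - C.ent (knowledge d k ℓ m ℓ) ≤ ((d : ℝ) - ℓ) * β := by
  rw [← ent_knowledge_union_repair hregen hk hℓ, sub_le_iff_le_add']
  refine (C.ent_union_image_le _ _ _ (fun _ => β) fun i hi => ?_).trans_eq ?_
  · refine (C.ent_union_le _ _).trans (add_le_add le_rfl ?_)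
    simp only [Finset.mem_Ioc] at hi
    rw [← HL_singleton]
    exact hβ _ (by simp; omega) _ (by simp; omega) (by omega)
  · have : ((d + 1 - (ℓ + 1) : ℕ) : ℝ) = d - ℓ := by
      rw [Nat.add_sub_add_right, Nat.cast_sub hℓ]
    rw [Finset.sum_const, Nat.card_Ioc, nsmul_eq_mul, this]

end Code

theorem T_succ (d : ℕ) {k ℓ : ℕ} (h : ℓ ≤ k) : T d (k + 1) ℓ = T d k ℓ + ((d : ℝ) - k) := by
  rw [T, T, Finset.sum_Icc_succ_top (by omega)]
  push_cast
  ring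

theorem T_self (d ℓ : ℕ) : T d ℓ ℓ = 0 := by
  simp [T]

theorem T_pos {d k ℓ : ℕ} (h : ℓ < k) (hk : k ≤ d) : 0 < T d k ℓ := by
  refine Finset.sum_pos (fun t ht => ?_) ⟨k, by simp; omega⟩
  have : (t : ℝ) ≤ d := by exact_mod_cast (Finset.mem_Icc.1 ht).2.trans hk
  linarith

/-- If the increments of `e` divided by the weights `d - t` are antitone, the increment at `m` is
at most its weighted share of the total increment. -/
theorem T_mul_increment_le {d ℓ : ℕ} {e : ℕ → ℝ}
    (h : ∀ t, ℓ ≤ t → t + 1 ≤ d →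
      ((d : ℝ) - t) * (e (t + 2) - e (t + 1)) ≤ ((d : ℝ) - t - 1) * (e (t + 1) - e t))
    {m : ℕ} (hℓ : ℓ ≤ m) (hm : m ≤ d) :
    T d m ℓ * (e (m + 1) - e m) ≤ ((d : ℝ) - m) * (e m - e ℓ) := by
  induction m, hℓ using Nat.le_induction with
  | base => simp [T_self]
  | succ m hℓ ih =>
    have ih := ih (by omega)
    have hstep := h m hℓ hm
    have hd : (m : ℝ) + 1 ≤ d := by exact_mod_cast hm
    have hT : 0 ≤ T d m ℓ := by
      rcases hℓ.eq_or_lt with rfl | hlt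
      · exact (T_self d _).ge
      · exact (T_pos hlt (by omega)).le
    rw [T_succ d hℓ]
    push_cast
    refine le_of_mul_le_mul_left ?_ (by linarith : (0 : ℝ) < (d : ℝ) - m)
    have a := mul_le_mul_of_nonneg_left hstep hT
    have b := mul_le_mul_of_nonneg_left ih (by linarith : (0 : ℝ) ≤ (d : ℝ) - m - 1)
    have c := mul_le_mul_of_nonneg_left hstep (by linarith : (0 : ℝ) ≤ (d : ℝ) - m)
    nlinarith

theorem statement0 {Ω V : Type} [Fintype Ω] {d : ℕ} (hd : 1 ≤ d)
    {ℓ₁ ℓ₂ ℓ : ℕ} (hℓdef : ℓ = ℓ₁ + ℓ₂) (hℓd : ℓ < d)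
    (C : Code Ω V d) (hsym : C.Symmetrical) (hregen : C.NodeRegen)
    (hrec : C.MsgRecovery ℓ) (hsec : C.RepairSecrecy ℓ₁ ℓ₂)
    (β : ℝ)
    (hβ : ∀ i ∈ Finset.Icc 1 (d + 1), ∀ j ∈ Finset.Icc 1 (d + 1), i ≠ j →
      C.HL [Atom.S i j] ≤ β) :
    β ≥ ∑ j ∈ Finset.Icc (ℓ + 1) d, (T d j ℓ)⁻¹ * C.HL [Atom.M j] := by
  set e : ℕ → ℕ → ℝ := fun m t => C.ent (knowledge d ℓ₁ ℓ m t) with he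
  have mono : ∀ m t, ℓ ≤ t → e m ℓ ≤ e m t := fun m t ht =>
    (Code.Determines.of_subset C (knowledge_mono le_rfl ht)).ent_le
  have message : ∀ m, ℓ ≤ m → m + 1 ≤ d →
      C.HL [Atom.M (m + 1)] + (e (m + 1) (m + 1) - e (m + 1) ℓ) ≤ e m (m + 1) - e m ℓ := by
    intro m hm hmd
    have h1 := Code.ent_knowledge_recover (k := ℓ₁) hrec hm hmd
    subst hℓdef
    have h2 := Code.ent_message_le hregen hsec hm hmd
    rw [C.HL_singleton]
    simp only [he]
    linarith
  have growth : ∀ m, ℓ < m → m + 1 ≤ d →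
      (T d (m + 1) ℓ)⁻¹ * (e m (m + 1) - e m ℓ) ≤ (T d m ℓ)⁻¹ * (e m m - e m ℓ) := by
    intro m hm hmd
    have h := T_mul_increment_le (e := e m) (fun t ht htd =>
      Code.increment_exchange hsym hregen (by omega : ℓ₁ ≤ t) htd) hm.le (by omega)
    have hT := T_pos hm (by omega : m ≤ d)
    have hT' := T_pos (by omega : ℓ < m + 1) hmd
    rw [inv_mul_le_iff₀ hT', mul_left_comm, le_inv_mul_iff₀ hT, T_succ d hm.le]
    linarith
  have bound : ∀ m, ℓ ≤ m → m + 1 ≤ d →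
      ∑ j ∈ Finset.Icc (ℓ + 1) m, (T d j ℓ)⁻¹ * C.HL [Atom.M j] +
        (T d (m + 1) ℓ)⁻¹ * (e m (m + 1) - e m ℓ) ≤ β := by
    intro m hm
    induction m, hm using Nat.le_induction with
    | base =>
      intro hmd
      have h := Code.ent_first_increment_le hregen hβ (m := ℓ) (by omega : ℓ₁ ≤ ℓ) hℓd.le
      have hT := T_pos ℓ.lt_succ_self hmd
      rw [Finset.Icc_eq_empty (by omega), Finset.sum_empty, zero_add, inv_mul_le_iff₀ hT,
        T_succ d le_rfl, T_self, zero_add]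
      exact h
    | succ m hm ih =>
      intro hmd
      have h1 := ih (by omega)
      have h2 := growth (m + 1) (by omega) hmd
      have h3 := mul_le_mul_of_nonneg_left (message m hm (by omega))
        (inv_nonneg.2 (T_pos (by omega : ℓ < m + 1) (by omega : m + 1 ≤ d)).le)
      rw [Finset.sum_Icc_succ_top (by omega)]
      linarith
  obtain ⟨m, rfl⟩ : ∃ m, d = m + 1 := ⟨d - 1, by omega⟩
  have hm : ℓ ≤ m := by omega
  have h1 := bound m hm le_rfl
  have hT := inv_nonneg.2 (T_pos hℓd le_rfl).le
  have h2 := mul_le_mul_of_nonneg_left (message m hm le_rfl) hT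
  have h3 := mul_nonneg hT (sub_nonneg.2 (mono (m + 1) (m + 1) (by omega)))
  rw [Finset.sum_Icc_succ_top (by omega)]
  linarith

end

end MDCSR
end

section
/- The following two conditions are equivalent: (i) 2ℓ ≤ d; (ii) for all real numbers ᾱ and all real β̄ with β̄ ≥ c, if ᾱ + (d(d−1)/2)·β̄ ≥ (d(d+1)/2)·c then ᾱ + (d(d−ℓ)−ℓ)·β̄ ≥ (d−ℓ)(d+1)·c. That is, the outer bound ᾱ + (d(d−1)/2)β̄ ≥ (d(d+1)/2)c (bound (12), the ℓ₁ = 0 case of the new bound) is stronger than the previously known bound ᾱ + (d(d−ℓ)−ℓ)β̄ ≥ (d−ℓ)(d+1)c on the region β̄ ≥ c if and only if ℓ ≤ d/2. -/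
open scoped BigOperators Classical

namespace MDCSR

noncomputable section

variable {Ω V : Type} [Fintype Ω]

variable {d : ℕ}

theorem statement3 {d ℓ : ℕ} (hℓd : ℓ < d) (c : ℝ) (hc : 0 ≤ c) :
    2 * ℓ ≤ d ↔
      ∀ α β : ℝ, β ≥ c →
        α + ((d : ℝ) * ((d : ℝ) - 1) / 2) * β ≥ ((d : ℝ) * ((d : ℝ) + 1) / 2) * c →
        α + ((d : ℝ) * ((d : ℝ) - (ℓ : ℝ)) - (ℓ : ℝ)) * β ≥
          ((d : ℝ) - (ℓ : ℝ)) * ((d : ℝ) + 1) * c := by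
  have hd : (0 : ℝ) < (d : ℝ) + 1 := by positivity
  constructor
  · intro h α β hβ hα
    have h' : 0 ≤ (d : ℝ) - 2 * ℓ := sub_nonneg.mpr (by exact_mod_cast h)
    have := mul_nonneg (mul_nonneg hd.le h') (sub_nonneg.mpr hβ)
    linarith
  · intro h
    have h' := h ((d : ℝ) * ((d : ℝ) + 1) / 2 * c - (d : ℝ) * ((d : ℝ) - 1) / 2 * (c + 1))
      (c + 1) (by linarith) (by linarith)
    have hmul : 0 ≤ ((d : ℝ) + 1) * ((d : ℝ) - 2 * ℓ) := by linarith
    have := nonneg_of_mul_nonneg_right hmul hd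
    exact_mod_cast sub_nonneg.mp this

end

end MDCSR
end

section
/- (Lemma 1) Let d ≥ 1 and n = d+1. For any code that satisfies node regeneration, and for any s ∈ [1:n] and t ∈ [0:s−1], the tuple (S̲_{→[t+1:s]}, W_{[t+1:s]}) is a deterministic function of U^{(t,s)}; equivalently, H(S̲_{→[t+1:s]}, W_{[t+1:s]} | U^{(t,s)}) = 0. -/
open scoped BigOperators Classical

namespace MDCSR

noncomputable section

variable {Ω V : Type} [Fintype Ω]

variable {d : ℕ}

theorem IsFuncOf.eq_of_eq {Ω α β : Type*} {X : Ω → α} {Y : Ω → β} (h : IsFuncOf X Y)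
    {ω ω' : Ω} (hY : Y ω = Y ω') : X ω = X ω' := by
  obtain ⟨f, hf⟩ := h
  rw [hf, hf, hY]

theorem isFuncOf_of_forall_eq {Ω α β : Type*} [Nonempty α] {X : Ω → α} {Y : Ω → β}
    (h : ∀ ω ω', Y ω = Y ω' → X ω = X ω') : IsFuncOf X Y := by
  have hX : X.FactorsThrough Y := fun ω ω' hY => h ω ω' hY
  obtain ⟨f, hf⟩ := (Function.factorsThrough_iff X).1 hX
  exact ⟨f, fun ω => congrFun hf ω⟩

theorem H_congr (p : Ω → ℝ) {α β : Type*} {X : Ω → α} {Y : Ω → β}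
    (h : ∀ ω ω', X ω = X ω' ↔ Y ω = Y ω') : H p X = H p Y := by
  simp only [H, pm, h]

theorem Code.rv_eq_iff_s4 (C : Code Ω V d) {L : List Atom} {ω ω' : Ω} :
    C.rv L ω = C.rv L ω' ↔ ∀ a ∈ L, C.atomRV a ω = C.atomRV a ω' := by
  simp only [Code.rv, List.map_inj_left]

theorem Code.CH_eq_zero_of_isFuncOf (C : Code Ω V d) {L₁ L₂ : List Atom}
    (h : IsFuncOf (C.rv L₁) (C.rv L₂)) : C.CH L₁ L₂ = 0 := by
  refine sub_eq_zero.2 (H_congr C.p fun ω ω' => ?_)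
  constructor
  · simp only [C.rv_eq_iff_s4, List.mem_append]
    exact fun hL a ha => hL a (Or.inr ha)
  · intro hL
    have h₁ := h.eq_of_eq hL
    rw [C.rv_eq_iff_s4] at hL h₁ ⊢
    intro a ha
    exact (List.mem_append.1 ha).elim (h₁ a) (hL a)

/-- Repair data agree on two outcomes as soon as the contents of the sending node do. -/
theorem Code.S_eq_of_W_eq_s4 (C : Code Ω V d) {i j : ℕ} (hi : 1 ≤ i) (hij : i < j)
    (hj : j ≤ d + 1) {ω ω' : Ω} (hW : C.W i ω = C.W i ω') : C.S i j ω = C.S i j ω' :=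
  (C.S_func i (Finset.mem_Icc.2 ⟨hi, by omega⟩) j (Finset.mem_Icc.2 ⟨by omega, hj⟩)
    hij.ne).eq_of_eq hW

/-- Two outcomes with the same `U^{(t,s)}` have the same contents of the first `s` nodes:
the nodes after `t` are regenerated one after the other. -/
theorem Code.NodeRegen.W_eq_of_U_eq {C : Code Ω V d} (hregen : C.NodeRegen) {s t : ℕ}
    (hs : s ≤ d + 1) {ω ω' : Ω} (hU : C.rv (U d t s) ω = C.rv (U d t s) ω')
    {j : ℕ} (hj : 1 ≤ j) (hjs : j ≤ s) : C.W j ω = C.W j ω' := by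
  rw [C.rv_eq_iff_s4] at hU
  induction j using Nat.strong_induction_on with
  | _ j ih =>
    by_cases hjt : j ≤ t
    · exact hU (.W j) (List.mem_append_left _ (List.mem_map_of_mem (mem_icc.2 ⟨hj, hjt⟩)))
    · refine (hregen j (Finset.mem_Icc.2 ⟨hj, by omega⟩)).eq_of_eq (C.rv_eq_iff_s4.2 ?_)
      intro a ha
      obtain ⟨i, hi, rfl⟩ := List.mem_map.1 ha
      simp only [List.mem_filter, mem_icc, decide_eq_true_eq] at hi
      obtain ⟨⟨hi₁, hi₂⟩, hij⟩ := hi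
      rcases Nat.lt_or_gt_of_ne hij with hlt | hgt
      · exact C.S_eq_of_W_eq_s4 hi₁ hlt (by omega) (ih i hlt hi₁ (by omega))
      · refine hU (.S i j) (List.mem_append_right _ (List.mem_flatten.2
          ⟨SbarTo d j, List.mem_map_of_mem (mem_icc.2 ⟨by omega, hjs⟩),
            List.mem_map.2 ⟨i, mem_icc.2 ⟨hgt, hi₂⟩, rfl⟩⟩))

theorem statement4 {Ω V : Type} [Fintype Ω] {d : ℕ} (hd : 1 ≤ d)
    (C : Code Ω V d) (hregen : C.NodeRegen)
    {s t : ℕ} (hs : s ∈ Finset.Icc 1 (d + 1)) (ht : t ∈ Finset.Icc 0 (s - 1)) :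
    IsFuncOf (C.rv (SunderToL (icc (t + 1) s) ++ Ws (icc (t + 1) s))) (C.rv (U d t s)) ∧
      C.CH (SunderToL (icc (t + 1) s) ++ Ws (icc (t + 1) s)) (U d t s) = 0 := by
  have hsn : s ≤ d + 1 := (Finset.mem_Icc.1 hs).2
  have hfunc : IsFuncOf (C.rv (SunderToL (icc (t + 1) s) ++ Ws (icc (t + 1) s)))
      (C.rv (U d t s)) := by
    refine isFuncOf_of_forall_eq fun ω ω' hU => C.rv_eq_iff_s4.2 fun a ha => ?_
    rcases List.mem_append.1 ha with ha | ha
    · obtain ⟨_, hl, ha⟩ := List.mem_flatten.1 ha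
      obtain ⟨j, hj, rfl⟩ := List.mem_map.1 hl
      obtain ⟨i, hi, rfl⟩ := List.mem_map.1 ha
      rw [mem_icc] at hi hj
      exact C.S_eq_of_W_eq_s4 hi.1 (by omega) (by omega)
        (hregen.W_eq_of_U_eq hsn hU hi.1 (by omega))
    · obtain ⟨j, hj, rfl⟩ := List.mem_map.1 ha
      rw [mem_icc] at hj
      exact hregen.W_eq_of_U_eq hsn hU (by omega) hj.2
  exact ⟨hfunc, C.CH_eq_zero_of_isFuncOf hfunc⟩

end

end MDCSR
end
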